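/- If a cardinal κ is both λ-strong and λ-strongly compact for some λ ≥ κ, then there is an elementary embedding j : V → M with crit(j) = κ, j(κ) > λ, V_λ ⊆ M, satisfying the weak λ-covering property. Furthermore, if κ is also λ-strong for a set A, then j can additionally be chosen so that A ∩ V_λ = j(A) ∩ V_λ. -/

import Mathlib

/-!
A framework for formalizing large-cardinal notions from
"Woodin for strong compactness cardinals" over the Mathlib model `ZFSet`
of ZFC.  The ambient set-theoretic universe `V` is the type `ZFSet`;
classes are sets `Set ZFSet`; everything is relativised to a "universe
class" `W : Set ZFSet` (the ambient universe being `W = Set.univ`), so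
that the same definitions can also be interpreted inside transitive set
models of ZFC (used to express the forcing/consistency results).
-/

namespace WSC

/-! ### First-order formulas in the language of set theory -/

/-- First-order formulas in the language `{∈}`, with `n` free (de Bruijn) variables. -/
inductive Fml : ℕ → Type where
  | mem {n} : Fin n → Fin n → Fml n
  | eq  {n} : Fin n → Fin n → Fml n
  | not {n} : Fml n → Fml n
  | and {n} : Fml n → Fml n → Fml n
  | ex  {n} : Fml (n + 1) → Fml n

namespace Fml

/-- Realization of a formula over the class `C`, with all quantifiers relativised to `C`. -/
def Realize (C : Set ZFSet) : ∀ {n}, Fml n → (Fin n → ZFSet) → Prop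
  | _, .mem i j, v => v i ∈ v j
  | _, .eq i j, v => v i = v j
  | _, .not φ, v => ¬ Realize C φ v
  | _, .and φ ψ, v => Realize C φ v ∧ Realize C ψ v
  | _, .ex φ, v => ∃ x ∈ C, Realize C φ (Fin.snoc v x)

def or {n} (φ ψ : Fml n) : Fml n := .not (.and (.not φ) (.not ψ))
def imp {n} (φ ψ : Fml n) : Fml n := Fml.or (.not φ) ψ
def iff {n} (φ ψ : Fml n) : Fml n := .and (imp φ ψ) (imp ψ φ)
def all {n} (φ : Fml (n + 1)) : Fml n := .not (.ex (.not φ))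

/-- Universal closure. -/
def alls : ∀ {n}, Fml n → Fml 0
  | 0, φ => φ
  | _ + 1, φ => alls (all φ)

/-- Renaming of variables. -/
def rename : ∀ {n m}, (Fin n → Fin m) → Fml n → Fml m
  | _, _, f, .mem i j => .mem (f i) (f j)
  | _, _, f, .eq i j => .eq (f i) (f j)
  | _, _, f, .not φ => .not (rename f φ)
  | _, _, f, .and φ ψ => .and (rename f φ) (rename f ψ)
  | _, _, f, .ex φ => .ex (rename (Fin.snoc (fun i => (f i).castSucc) (Fin.last _)) φ)

end Fml

/-- A sentence `φ` holds in the class `C`. -/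
def Sat (C : Set ZFSet) (φ : Fml 0) : Prop := Fml.Realize C φ (fun i => i.elim0)

/-! ### The ZFC axioms -/

def extAx : Fml 0 :=
  Fml.all (Fml.all (Fml.imp (Fml.all (Fml.iff (.mem 2 0) (.mem 2 1))) (.eq 0 1)))

def pairAx : Fml 0 := Fml.all (Fml.all (Fml.ex (Fml.and (.mem 0 2) (.mem 1 2))))

def unionAx : Fml 0 :=
  Fml.all (Fml.ex (Fml.all (Fml.all
    (Fml.imp (Fml.and (.mem 2 3) (.mem 3 0)) (.mem 2 1)))))

def powerAx : Fml 0 :=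
  Fml.all (Fml.ex (Fml.all
    (Fml.imp (Fml.all (Fml.imp (.mem 3 2) (.mem 3 0))) (.mem 2 1))))

def infAx : Fml 0 :=
  Fml.ex (Fml.and
    (Fml.ex (Fml.and (.mem 1 0) (Fml.all (Fml.not (.mem 2 1)))))
    (Fml.all (Fml.imp (.mem 1 0)
      (Fml.ex (Fml.and (.mem 2 0)
        (Fml.all (Fml.iff (.mem 3 2) (Fml.or (.mem 3 1) (.eq 3 1)))))))))

def foundAx : Fml 0 :=
  Fml.all (Fml.imp (Fml.ex (.mem 1 0))
    (Fml.ex (Fml.and (.mem 1 0) (Fml.all (Fml.imp (.mem 2 1) (Fml.not (.mem 2 0)))))))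

def choiceAx : Fml 0 :=
  Fml.all (Fml.imp
    (Fml.and
      (Fml.all (Fml.imp (.mem 1 0) (Fml.ex (.mem 2 1))))
      (Fml.all (Fml.all (Fml.imp
        (Fml.and (.mem 1 0) (Fml.and (.mem 2 0) (Fml.ex (Fml.and (.mem 3 1) (.mem 3 2)))))
        (.eq 1 2)))))
    (Fml.ex (Fml.all (Fml.imp (.mem 2 0)
      (Fml.ex (Fml.and (Fml.and (.mem 3 2) (.mem 3 1))
        (Fml.all (Fml.imp (Fml.and (.mem 4 2) (.mem 4 1)) (.eq 4 3)))))))))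

/-- An instance of the separation schema, for a formula `φ` with parameters
`0, …, n-1` and distinguished variable `n`. -/
def sepAx (n : ℕ) (φ : Fml (n + 1)) : Fml 0 :=
  Fml.alls ((Fml.ex (Fml.all (Fml.iff
    (Fml.mem (⟨n + 2, by omega⟩ : Fin (n + 3)) ⟨n + 1, by omega⟩)
    (Fml.and (Fml.mem (⟨n + 2, by omega⟩ : Fin (n + 3)) ⟨n, by omega⟩)
      (Fml.rename (fun i => if h : (i : ℕ) < n then (⟨i, by omega⟩ : Fin (n + 3))
        else ⟨n + 2, by omega⟩) φ))))) : Fml (n + 1))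

/-- An instance of the collection schema, for a formula `φ` with parameters
`0, …, n-1` and distinguished variables `n` (input) and `n+1` (output). -/
def collAx (n : ℕ) (φ : Fml (n + 2)) : Fml 0 :=
  let φ' : Fml (n + 4) := Fml.rename (fun i => if h : (i : ℕ) < n then (⟨i, by omega⟩ : Fin (n + 4))
    else ⟨(i : ℕ) + 2, by have := i.isLt; omega⟩) φ
  Fml.alls ((Fml.ex (Fml.all
    (Fml.imp (Fml.mem (⟨n + 2, by omega⟩ : Fin (n + 3)) ⟨n, by omega⟩)
      (Fml.imp (Fml.ex φ')
        (Fml.ex (Fml.and (Fml.mem (⟨n + 3, by omega⟩ : Fin (n + 4)) ⟨n + 1, by omega⟩) φ')))))) : Fml (n + 1))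

/-- The ZFC axioms. -/
def ZFCax : Set (Fml 0) :=
  {extAx, pairAx, unionAx, powerAx, infAx, foundAx, choiceAx} ∪
    (⋃ n, Set.range (sepAx n)) ∪ (⋃ n, Set.range (collAx n))

/-- A transitive set model of ZFC. -/
def IsZFModel (m : ZFSet) : Prop := m.IsTransitive ∧ ∀ φ ∈ ZFCax, Sat m.toSet φ

/-- A countable transitive model of ZFC. -/
def IsCtm (m : ZFSet) : Prop := IsZFModel m ∧ m.toSet.Countable

/-! ### Basic set-theoretic notions -/

/-- `x` is a (von Neumann) ordinal: a transitive set of transitive sets. -/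
def IsOrd (x : ZFSet) : Prop := x.IsTransitive ∧ ∀ y ∈ x, ZFSet.IsTransitive y

/-- `x ≤ y` for ordinals. -/
def oLe (x y : ZFSet) : Prop := x ∈ y ∨ x = y

/-- `f` is a function with domain `d` (coded as a set of Kuratowski pairs). -/
def IsFuncOn (d f : ZFSet) : Prop :=
  (∀ p ∈ f, ∃ a b : ZFSet, a ∈ d ∧ p = a.pair b) ∧ ∀ a ∈ d, ∃! b : ZFSet, a.pair b ∈ f

/-- All values of the (partial) function `f` lie in `b`. -/
def MapsInto (f b : ZFSet) : Prop := ∀ x y : ZFSet, x.pair y ∈ f → y ∈ b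

/-- The function `f` is injective. -/
def InjFun (f : ZFSet) : Prop := ∀ x x' y : ZFSet, x.pair y ∈ f → x'.pair y ∈ f → x = x'

/-- `|a| ≤ |b|`, witnessed by an injection belonging to the universe class `W`. -/
def SetLeIn (W : Set ZFSet) (a b : ZFSet) : Prop :=
  ∃ f ∈ W, IsFuncOn a f ∧ MapsInto f b ∧ InjFun f

/-- `κ` is a cardinal (relative to the universe class `W`). -/
def IsCardIn (W : Set ZFSet) (κ : ZFSet) : Prop :=
  IsOrd κ ∧ ∀ α ∈ κ, ¬ SetLeIn W κ α

/-- `M` is a transitive class. -/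
def TransClass (M : Set ZFSet) : Prop := ∀ x ∈ M, ∀ y : ZFSet, y ∈ x → y ∈ M

/-- An elementary embedding `j : (W, ∈) → (M, ∈)` between two classes. -/
structure ElemEmb (W M : Set ZFSet) where
  toFun : ZFSet → ZFSet
  maps : ∀ x ∈ W, toFun x ∈ M
  elem : ∀ {n : ℕ} (φ : Fml n) (v : Fin n → ZFSet), (∀ i, v i ∈ W) →
    (Fml.Realize W φ v ↔ Fml.Realize M φ (fun i => toFun (v i)))

/-- `κ` is the critical point of `j`: the least ordinal moved. -/
def IsCrit {W M : Set ZFSet} (j : ElemEmb W M) (κ : ZFSet) : Prop :=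
  IsOrd κ ∧ j.toFun κ ≠ κ ∧ ∀ α ∈ κ, j.toFun α = α

/-! ### The rank hierarchy -/

/-- `x ∈ V_lam`. -/
def VMem (lam x : ZFSet) : Prop := x.rank < lam.rank

/-- `V_lam ⊆ M` (with `V_lam` computed in the universe class `W`). -/
def VInclIn (W M : Set ZFSet) (lam : ZFSet) : Prop := ∀ x ∈ W, VMem lam x → x ∈ M

/-- `A ⊆ V_δ`. -/
def SubV (A δ : ZFSet) : Prop := ∀ x ∈ A, VMem δ x

/-- `A ∩ V_lam = B ∩ V_lam`. -/
def AgreeBelowIn (W : Set ZFSet) (lam A B : ZFSet) : Prop :=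
  ∀ x ∈ W, VMem lam x → (x ∈ A ↔ x ∈ B)

/-- `A ∩ lam = B ∩ lam` (for sets of ordinals). -/
def AgreeMem (lam A B : ZFSet) : Prop := ∀ ξ ∈ lam, (ξ ∈ A ↔ ξ ∈ B)

/-! ### Covering properties -/

/-- `M ⊨ |s| < t`: in `M` there is an injection of `s` into some ordinal `β ∈ t`. -/
def CardLtIn (M : Set ZFSet) (s t : ZFSet) : Prop :=
  ∃ β f : ZFSet, β ∈ t ∧ f ∈ M ∧ IsFuncOn s f ∧ MapsInto f β ∧ InjFun f

/-- `j` satisfies the weak `lam`-covering property (with target class `M`):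
there is `s ∈ M` with `j '' lam ⊆ s` and `M ⊨ |s| < j κ`. -/
def WCovers (M : Set ZFSet) (j : ZFSet → ZFSet) (κ lam : ZFSet) : Prop :=
  ∃ s ∈ M, (∀ α ∈ lam, j α ∈ s) ∧ CardLtIn M s (j κ)

/-- `j` satisfies the (full) `lam`-covering property: every `X ∈ W` with
`X ⊆ M` and `|X| ≤ lam` is covered by some `s ∈ M` with `M ⊨ |s| < j κ`. -/
def CoversIn (W M : Set ZFSet) (j : ZFSet → ZFSet) (κ lam : ZFSet) : Prop :=
  ∀ X ∈ W, X.toSet ⊆ M → SetLeIn W X lam → ∃ s ∈ M, X ⊆ s ∧ CardLtIn M s (j κ)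

/-! ### Strongness -/

/-- `κ` is `lam`-strong. -/
def LamStrongIn (W : Set ZFSet) (κ lam : ZFSet) : Prop :=
  ∃ M : Set ZFSet, M ⊆ W ∧ TransClass M ∧ ∃ j : ElemEmb W M,
    IsCrit j κ ∧ lam ∈ j.toFun κ ∧ VInclIn W M lam

/-- `κ` is `lam`-strong for `A`. -/
def LamStrongForIn (W : Set ZFSet) (κ lam A : ZFSet) : Prop :=
  ∃ M : Set ZFSet, M ⊆ W ∧ TransClass M ∧ ∃ j : ElemEmb W M,
    IsCrit j κ ∧ lam ∈ j.toFun κ ∧ VInclIn W M lam ∧ AgreeBelowIn W lam A (j.toFun A)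

/-- `κ` is `<δ`-strong. -/
def LtStrongIn (W : Set ZFSet) (κ δ : ZFSet) : Prop :=
  ∀ lam : ZFSet, oLe κ lam → lam ∈ δ → LamStrongIn W κ lam

/-- `κ` is `<δ`-strong for `A`. -/
def LtStrongForIn (W : Set ZFSet) (κ δ A : ZFSet) : Prop :=
  ∀ lam : ZFSet, oLe κ lam → lam ∈ δ → LamStrongForIn W κ lam A

/-! ### Strong compactness -/

/-- `κ` is `lam`-strongly compact (there is an embedding with critical point `κ`,
`j κ > lam`, satisfying the weak `lam`-covering property). -/
def LamSCIn (W : Set ZFSet) (κ lam : ZFSet) : Prop :=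
  ∃ M : Set ZFSet, M ⊆ W ∧ TransClass M ∧ ∃ j : ElemEmb W M,
    IsCrit j κ ∧ lam ∈ j.toFun κ ∧ WCovers M j.toFun κ lam

/-- `κ` is `lam`-strongly compact for the set of ordinals `A`: there is a
`lam`-strong compactness embedding `j` (one with the full `lam`-covering
property) with critical point `κ` and `A ∩ lam = j A ∩ lam`. -/
def LamSCForIn (W : Set ZFSet) (κ lam A : ZFSet) : Prop :=
  ∃ M : Set ZFSet, M ⊆ W ∧ TransClass M ∧ ∃ j : ElemEmb W M,
    IsCrit j κ ∧ lam ∈ j.toFun κ ∧ CoversIn W M j.toFun κ lam ∧ AgreeMem lam A (j.toFun A)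

/-- `κ` is `<δ`-strongly compact. -/
def LtSCIn (W : Set ZFSet) (κ δ : ZFSet) : Prop :=
  ∀ lam : ZFSet, oLe κ lam → lam ∈ δ → LamSCIn W κ lam

/-- `κ` is `<δ`-strongly compact for `A`. -/
def LtSCForIn (W : Set ZFSet) (κ δ A : ZFSet) : Prop :=
  ∀ lam : ZFSet, oLe κ lam → lam ∈ δ → LamSCForIn W κ lam A

/-! ### Supercompactness -/

/-- `M` is closed under `lam`-sequences (from the universe class `W`). -/
def SeqClosedIn (W M : Set ZFSet) (lam : ZFSet) : Prop :=
  ∀ f ∈ W, IsFuncOn lam f → (∀ x y : ZFSet, x.pair y ∈ f → y ∈ M) → f ∈ M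

/-- `κ` is `lam`-supercompact. -/
def LamSupercompactIn (W : Set ZFSet) (κ lam : ZFSet) : Prop :=
  ∃ M : Set ZFSet, M ⊆ W ∧ TransClass M ∧ ∃ j : ElemEmb W M,
    IsCrit j κ ∧ lam ∈ j.toFun κ ∧ SeqClosedIn W M lam

/-- `κ` is `lam`-supercompact for `A`. -/
def LamSupercompactForIn (W : Set ZFSet) (κ lam A : ZFSet) : Prop :=
  ∃ M : Set ZFSet, M ⊆ W ∧ TransClass M ∧ ∃ j : ElemEmb W M,
    IsCrit j κ ∧ lam ∈ j.toFun κ ∧ SeqClosedIn W M lam ∧ AgreeBelowIn W lam A (j.toFun A)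

/-- `κ` is `<δ`-supercompact. -/
def LtSupercompactIn (W : Set ZFSet) (κ δ : ZFSet) : Prop :=
  ∀ lam : ZFSet, oLe κ lam → lam ∈ δ → LamSupercompactIn W κ lam

/-- `κ` is `<δ`-supercompact for `A`. -/
def LtSupercompactForIn (W : Set ZFSet) (κ δ A : ZFSet) : Prop :=
  ∀ lam : ZFSet, oLe κ lam → lam ∈ δ → LamSupercompactForIn W κ lam A

/-! ### The global large-cardinal notions -/

/-- `δ` is a Woodin cardinal. -/
def WoodinIn (W : Set ZFSet) (δ : ZFSet) : Prop :=
  IsCardIn W δ ∧ ∀ A ∈ W, SubV A δ → ∃ κ, κ ∈ δ ∧ LtStrongForIn W κ δ A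

/-- `δ` is a Woodin for strong compactness cardinal. -/
def WoodinSCIn (W : Set ZFSet) (δ : ZFSet) : Prop :=
  IsCardIn W δ ∧ ∀ A ∈ W, A ⊆ δ → ∃ κ, κ ∈ δ ∧ LtSCForIn W κ δ A

/-- `δ` is a Vopěnka cardinal. -/
def VopenkaIn (W : Set ZFSet) (δ : ZFSet) : Prop :=
  IsCardIn W δ ∧ ∀ A ∈ W, SubV A δ → ∃ κ, κ ∈ δ ∧ LtSupercompactForIn W κ δ A

/-- `δ` is Woodin and a limit of `<δ`-supercompact cardinals. -/
def WoodinLimSupercompactIn (W : Set ZFSet) (δ : ZFSet) : Prop :=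
  WoodinIn W δ ∧ ∀ α ∈ δ, ∃ κ : ZFSet, α ∈ κ ∧ κ ∈ δ ∧ LtSupercompactIn W κ δ

/-! ### Inaccessibility -/

/-- `δ` is a regular ordinal: the range of any function from a smaller
ordinal into `δ` is bounded. -/
def RegularIn (W : Set ZFSet) (δ : ZFSet) : Prop :=
  IsOrd δ ∧ ∀ α ∈ δ, ∀ f ∈ W, IsFuncOn α f → MapsInto f δ →
    ∃ β ∈ δ, ∀ x y : ZFSet, x.pair y ∈ f → y ∈ β

/-- The power set of `x` relative to `W`. -/
def powersetIn (W : Set ZFSet) (x : ZFSet) : ZFSet := ZFSet.sep (fun z => z ∈ W) x.powerset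

/-- `δ` is a strong limit cardinal. -/
def StrongLimitIn (W : Set ZFSet) (δ : ZFSet) : Prop :=
  IsCardIn W δ ∧ ∀ α ∈ δ, ∃ β ∈ δ, SetLeIn W (powersetIn W α) β

/-- `δ` is inaccessible: an uncountable regular strong limit cardinal. -/
def InaccessibleIn (W : Set ZFSet) (δ : ZFSet) : Prop :=
  ZFSet.omega ∈ δ ∧ IsCardIn W δ ∧ RegularIn W δ ∧ StrongLimitIn W δ

/-! ### Ultrafilters and measurability -/

/-- Relative complement `a \ b`. -/
def zdiff (a b : ZFSet) : ZFSet := ZFSet.sep (fun x => x ∉ b) a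

/-- Intersection `a ∩ b`. -/
def zinter (a b : ZFSet) : ZFSet := ZFSet.sep (fun x => x ∈ b) a

/-- `U` is a nonprincipal `α`-complete ultrafilter on `α`. -/
def IsUfOnIn (W : Set ZFSet) (α U : ZFSet) : Prop :=
  (∀ x ∈ U, x ⊆ α) ∧ α ∈ U ∧ (∅ : ZFSet) ∉ U ∧
  (∀ x ∈ U, ∀ y : ZFSet, y ∈ W → y ⊆ α → x ⊆ y → y ∈ U) ∧
  (∀ x ∈ W, x ⊆ α → (x ∈ U ∨ zdiff α x ∈ U)) ∧
  (∀ β ∈ α, ∀ g ∈ W, IsFuncOn β g → MapsInto g U →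
    ZFSet.sep (fun ξ => ∀ p q : ZFSet, p.pair q ∈ g → ξ ∈ q) α ∈ U) ∧
  (∀ ξ ∈ α, ZFSet.sep (fun x => x = ξ) α ∉ U)

/-- `U` is a normal ultrafilter on `α`: a nonprincipal `α`-complete
ultrafilter closed under diagonal intersections. -/
def IsNormalUfOnIn (W : Set ZFSet) (α U : ZFSet) : Prop :=
  IsUfOnIn W α U ∧
    ∀ g ∈ W, IsFuncOn α g → MapsInto g U →
      ZFSet.sep (fun ξ => ∀ p q : ZFSet, p.pair q ∈ g → p ∈ ξ → ξ ∈ q) α ∈ U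

/-- `α` is a measurable cardinal. -/
def MeasurableIn (W : Set ZFSet) (α : ZFSet) : Prop := ∃ U ∈ W, IsUfOnIn W α U

/-! ### Functions `f : δ → δ` and closure points -/

/-- `f` codes a function from `δ` to `δ`. -/
def FuncSelf (δ f : ZFSet) : Prop := IsFuncOn δ f ∧ MapsInto f δ

/-- `κ` is a closure point of `f`, i.e. `f '' κ ⊆ κ`. -/
def ClosurePt (f κ : ZFSet) : Prop := ∀ x y : ZFSet, x.pair y ∈ f → x ∈ κ → y ∈ κ

/-! ### GCH -/

/-- GCH: for every infinite cardinal `κ`, any family of subsets of `κ` has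
size at most `κ` or size at least that of the full power set of `κ`. -/
def GCHIn (W : Set ZFSet) : Prop :=
  ∀ κ ∈ W, IsCardIn W κ → oLe ZFSet.omega κ →
    ∀ X ∈ W, (∀ z ∈ X, z ⊆ κ) → (SetLeIn W X κ ∨ SetLeIn W (powersetIn W κ) X)

/-! ### Forcing -/

/-- `(P, R)` is a forcing notion (a preordered set, `x.pair y ∈ R` meaning
`x ≤ y`, i.e. `x` is stronger than `y`). -/
def IsPoset (P R : ZFSet) : Prop :=
  (∀ p ∈ P, p.pair p ∈ R) ∧
  (∀ p q r : ZFSet, p.pair q ∈ R → q.pair r ∈ R → p.pair r ∈ R) ∧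
  (∀ x y : ZFSet, x.pair y ∈ R → x ∈ P ∧ y ∈ P)

/-- `G` is an `m`-generic filter on the forcing notion `(P, R) ∈ m`. -/
def IsGenericFilter (m P R G : ZFSet) : Prop :=
  G ⊆ P ∧
  (∀ p ∈ G, ∀ q ∈ P, p.pair q ∈ R → q ∈ G) ∧
  (∀ p ∈ G, ∀ q ∈ G, ∃ r ∈ G, r.pair p ∈ R ∧ r.pair q ∈ R) ∧
  (∀ D ∈ m, (D ⊆ P ∧ ∀ p ∈ P, ∃ q ∈ D, q.pair p ∈ R) → ∃ q, q ∈ G ∧ q ∈ D)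

/-- `n = m[G]` : `n` is a transitive ZFC-model extending `m` and containing
`G`, and is the least such. -/
def IsGenericExt (m G n : ZFSet) : Prop :=
  IsZFModel n ∧ m ⊆ n ∧ G ∈ n ∧
    ∀ n' : ZFSet, IsZFModel n' → m ⊆ n' → G ∈ n' → n ⊆ n'

/-- `n` is a (set-)forcing extension of the transitive model `m`. -/
def IsForcingExt (m n : ZFSet) : Prop :=
  ∃ P R G : ZFSet, P ∈ m ∧ R ∈ m ∧ IsPoset P R ∧
    IsGenericFilter m P R G ∧ IsGenericExt m G n

/-! ### Ambient (full-universe) abbreviations -/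

abbrev LamStrong (κ lam : ZFSet) : Prop := LamStrongIn Set.univ κ lam
abbrev LamStrongFor (κ lam A : ZFSet) : Prop := LamStrongForIn Set.univ κ lam A
abbrev LtStrong (κ δ : ZFSet) : Prop := LtStrongIn Set.univ κ δ
abbrev LtStrongFor (κ δ A : ZFSet) : Prop := LtStrongForIn Set.univ κ δ A
abbrev LamSC (κ lam : ZFSet) : Prop := LamSCIn Set.univ κ lam
abbrev LamSCFor (κ lam A : ZFSet) : Prop := LamSCForIn Set.univ κ lam A
abbrev LtSC (κ δ : ZFSet) : Prop := LtSCIn Set.univ κ δ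
abbrev LtSCFor (κ δ A : ZFSet) : Prop := LtSCForIn Set.univ κ δ A
abbrev LamSupercompact (κ lam : ZFSet) : Prop := LamSupercompactIn Set.univ κ lam
abbrev LtSupercompact (κ δ : ZFSet) : Prop := LtSupercompactIn Set.univ κ δ
abbrev Woodin (δ : ZFSet) : Prop := WoodinIn Set.univ δ
abbrev WoodinSC (δ : ZFSet) : Prop := WoodinSCIn Set.univ δ
abbrev Vopenka (δ : ZFSet) : Prop := VopenkaIn Set.univ δ
abbrev IsCard (κ : ZFSet) : Prop := IsCardIn Set.univ κ
abbrev Inaccessible (δ : ZFSet) : Prop := InaccessibleIn Set.univ δ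
abbrev Covers (M : Set ZFSet) (j : ZFSet → ZFSet) (κ lam : ZFSet) : Prop :=
  CoversIn Set.univ M j κ lam
abbrev VIncl (M : Set ZFSet) (lam : ZFSet) : Prop := VInclIn Set.univ M lam
abbrev AgreeBelow (lam A B : ZFSet) : Prop := AgreeBelowIn Set.univ lam A B
abbrev SeqClosed (M : Set ZFSet) (lam : ZFSet) : Prop := SeqClosedIn Set.univ M lam


/-! ### Auxiliary material for the proof -/

set_option linter.unusedSimpArgs false
set_option linter.unusedSectionVars false
set_option linter.unnecessarySeqFocus false

section Aux

universe u

/-! #### Skolem hulls -/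

/-- Skolem terms over generators `α`. -/
inductive Tm (α : Type u) : Type u where
  | base : α → Tm α
  | sk {n : ℕ} (φ : Fml (n + 1)) (v : Fin n → Tm α) : Tm α

open Classical in
/-- Evaluation of Skolem terms in the class `N`. -/
noncomputable def Tm.eval {α : Type u} (N : Set ZFSet.{u}) (d : ZFSet.{u}) (b : α → ZFSet.{u}) :
    Tm α → ZFSet.{u}
  | .base a => b a
  | .sk φ v =>
    if h : ∃ x ∈ N, Fml.Realize N φ (Fin.snoc (fun i => Tm.eval N d b (v i)) x : Fin _ → ZFSet)
    then Classical.choose h else d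

/-- `n` is an elementary substructure of the class `N`. -/
def ESub (n : ZFSet.{u}) (N : Set ZFSet.{u}) : Prop :=
  (∀ x ∈ n, x ∈ N) ∧ ∀ {k : ℕ} (φ : Fml k) (v : Fin k → ZFSet.{u}), (∀ i, v i ∈ n) →
    (Fml.Realize n.toSet φ v ↔ Fml.Realize N φ v)

theorem mem_toSet_iff (x n : ZFSet.{u}) : x ∈ n.toSet ↔ x ∈ n := Iff.rfl

theorem exists_hull (N : Set ZFSet.{u}) (d : ZFSet.{u}) (hd : d ∈ N) (a : ZFSet.{u})
    (ha : ∀ x ∈ a, x ∈ N) : ∃ n : ZFSet.{u}, a ⊆ n ∧ ESub n N := by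
  classical
  let α := Shrink.{u} a
  let b : α → ZFSet.{u} := fun x => ((equivShrink _).symm x).1
  have hN : ∀ t : Tm α, t.eval N d b ∈ N := by
    intro t
    cases t with
    | base x => exact ha _ ((equivShrink _).symm x).2
    | sk φ v =>
      rw [Tm.eval]
      split_ifs with h
      · exact (Classical.choose_spec h).1
      · exact hd
  refine ⟨ZFSet.range (Tm.eval N d b), ?_, ?_, ?_⟩
  · intro x hx
    rw [ZFSet.mem_range]
    refine ⟨.base (equivShrink _ ⟨x, hx⟩), ?_⟩
    simp [Tm.eval, b]
  · intro x hx
    rw [ZFSet.mem_range] at hx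
    obtain ⟨t, rfl⟩ := hx
    exact hN t
  · intro k φ
    induction φ with
    | mem i j => intro v _; exact Iff.rfl
    | eq i j => intro v _; exact Iff.rfl
    | not φ ih => intro v hv; exact not_congr (ih v hv)
    | and φ ψ ih1 ih2 => intro v hv; exact and_congr (ih1 v hv) (ih2 v hv)
    | @ex m φ ih =>
      intro v hv
      constructor
      · rintro ⟨x, hx, h⟩
        have hx' : x ∈ ZFSet.range (Tm.eval N d b) := hx
        refine ⟨x, ?_, (ih _ ?_).1 h⟩
        · rw [ZFSet.mem_range] at hx'
          obtain ⟨t, rfl⟩ := hx'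
          exact hN t
        · intro i
          refine Fin.lastCases ?_ (fun i => ?_) i
          · simpa using hx'
          · simpa using hv i
      · intro h
        have hv' : ∀ i, ∃ t, Tm.eval N d b t = v i := fun i => by
          have := hv i
          rwa [ZFSet.mem_range] at this
        choose t ht using hv'
        have hte : (fun i => Tm.eval N d b (t i)) = v := funext ht
        have h' : ∃ x ∈ N, Fml.Realize N φ
            (Fin.snoc (fun i => Tm.eval N d b (t i)) x : Fin _ → ZFSet) := by
          rw [hte]; exact h
        have hev : Tm.eval N d b (.sk φ t) = Classical.choose h' := by
          rw [Tm.eval, dif_pos h']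
        have hs := (Classical.choose_spec h').2
        rw [← hev, hte] at hs
        have hmem : Tm.eval N d b (.sk φ t) ∈ ZFSet.range (Tm.eval N d b) := by
          rw [ZFSet.mem_range]; exact ⟨_, rfl⟩
        refine ⟨_, hmem, (ih _ ?_).2 hs⟩
        intro i
        refine Fin.lastCases ?_ (fun i => ?_) i
        · simpa using hmem
        · simpa using hv i

/-! #### Relativised formulas -/

/-- Relativisation of a formula to (the elements of) the variable `c`. -/
def Fml.rel : ∀ {n m : ℕ}, (Fin n → Fin m) → Fin m → Fml n → Fml m
  | _, _, f, _, .mem i j => .mem (f i) (f j)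
  | _, _, f, _, .eq i j => .eq (f i) (f j)
  | _, _, f, c, .not φ => .not (Fml.rel f c φ)
  | _, _, f, c, .and φ ψ => .and (Fml.rel f c φ) (Fml.rel f c ψ)
  | _, _, f, c, .ex φ => .ex (.and (.mem (Fin.last _) c.castSucc)
      (Fml.rel (Fin.snoc (fun i => (f i).castSucc) (Fin.last _)) c.castSucc φ))

theorem realize_rel (C : Set ZFSet.{u}) {n : ℕ} (φ : Fml n) :
    ∀ {m : ℕ} (f : Fin n → Fin m) (c : Fin m) (v : Fin m → ZFSet.{u}),
    (∀ x ∈ v c, x ∈ C) →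
    (Fml.Realize C (Fml.rel f c φ) v ↔ Fml.Realize (v c).toSet φ (fun i => v (f i))) := by
  induction φ with
  | mem i j => intro m f c v _; exact Iff.rfl
  | eq i j => intro m f c v _; exact Iff.rfl
  | not φ ih => intro m f c v hv; exact not_congr (ih f c v hv)
  | and φ ψ ih1 ih2 => intro m f c v hv; exact and_congr (ih1 f c v hv) (ih2 f c v hv)
  | @ex k φ ih =>
    intro m f c v hv
    have key : ∀ x : ZFSet.{u}, (fun i => (Fin.snoc v x : Fin (m + 1) → ZFSet)
        ((Fin.snoc (fun i => (f i).castSucc) (Fin.last _) : Fin (k + 1) → Fin (m + 1)) i))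
        = (Fin.snoc (fun i => v (f i)) x : Fin (k + 1) → ZFSet) := by
      intro x
      funext i
      refine Fin.lastCases ?_ (fun i => ?_) i <;> simp
    constructor
    · rintro ⟨x, hx, hm, h⟩
      have hm' : x ∈ v c := by
        change (Fin.snoc v x : Fin (m + 1) → ZFSet) (Fin.last _) ∈
          (Fin.snoc v x : Fin (m + 1) → ZFSet) c.castSucc at hm
        simpa using hm
      refine ⟨x, hm', ?_⟩
      have := (ih _ _ (Fin.snoc v x : Fin (m + 1) → ZFSet) (by simpa using hv)).1 h
      rw [key] at this
      simpa using this
    · rintro ⟨x, hx, h⟩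
      have hx' : x ∈ v c := hx
      refine ⟨x, hv x hx', ?_, ?_⟩
      · change (Fin.snoc v x : Fin (m + 1) → ZFSet) (Fin.last _) ∈
          (Fin.snoc v x : Fin (m + 1) → ZFSet) c.castSucc
        simpa using hx'
      · refine (ih _ _ (Fin.snoc v x : Fin (m + 1) → ZFSet) (by simpa using hv)).2 ?_
        rw [key]
        simpa using h

/-- Quantify the last `k` variables universally over the elements of variable `c`. -/
def Fml.ballK {m : ℕ} (c : Fin m) : ∀ k : ℕ, Fml (m + k) → Fml m
  | 0, φ => φ
  | k + 1, φ => Fml.ballK c k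
      (Fml.all (Fml.imp (.mem (Fin.last (m + k)) (Fin.castAdd k c).castSucc) φ))

theorem realize_not (C : Set ZFSet.{u}) {n : ℕ} (φ : Fml n) (v : Fin n → ZFSet.{u}) :
    Fml.Realize C (.not φ) v ↔ ¬ Fml.Realize C φ v := Iff.rfl

theorem realize_and (C : Set ZFSet.{u}) {n : ℕ} (φ ψ : Fml n) (v : Fin n → ZFSet.{u}) :
    Fml.Realize C (.and φ ψ) v ↔ Fml.Realize C φ v ∧ Fml.Realize C ψ v := Iff.rfl

theorem realize_or (C : Set ZFSet.{u}) {n : ℕ} (φ ψ : Fml n) (v : Fin n → ZFSet.{u}) :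
    Fml.Realize C (Fml.or φ ψ) v ↔ Fml.Realize C φ v ∨ Fml.Realize C ψ v := by
  simp only [Fml.or, realize_not, realize_and]; tauto

theorem realize_imp (C : Set ZFSet.{u}) {n : ℕ} (φ ψ : Fml n) (v : Fin n → ZFSet.{u}) :
    Fml.Realize C (Fml.imp φ ψ) v ↔ (Fml.Realize C φ v → Fml.Realize C ψ v) := by
  simp only [Fml.imp, realize_or, realize_not]; tauto

theorem realize_iff (C : Set ZFSet.{u}) {n : ℕ} (φ ψ : Fml n) (v : Fin n → ZFSet.{u}) :
    Fml.Realize C (Fml.iff φ ψ) v ↔ (Fml.Realize C φ v ↔ Fml.Realize C ψ v) := by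
  simp only [Fml.iff, realize_imp, realize_and]; tauto

theorem realize_ex (C : Set ZFSet.{u}) {n : ℕ} (φ : Fml (n + 1)) (v : Fin n → ZFSet.{u}) :
    Fml.Realize C (.ex φ) v ↔ ∃ x ∈ C, Fml.Realize C φ (Fin.snoc v x : Fin (n + 1) → ZFSet) :=
  Iff.rfl

theorem realize_all (C : Set ZFSet.{u}) {n : ℕ} (φ : Fml (n + 1)) (v : Fin n → ZFSet.{u}) :
    Fml.Realize C (Fml.all φ) v ↔
      ∀ x ∈ C, Fml.Realize C φ (Fin.snoc v x : Fin (n + 1) → ZFSet) := by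
  simp only [Fml.all, realize_not, realize_ex]; push Not; rfl

theorem realize_mem (C : Set ZFSet.{u}) {n : ℕ} (i j : Fin n) (v : Fin n → ZFSet.{u}) :
    Fml.Realize C (.mem i j) v ↔ v i ∈ v j := Iff.rfl

theorem realize_ballK (C : Set ZFSet.{u}) {m : ℕ} (c : Fin m) (w : Fin m → ZFSet.{u})
    (hw : ∀ x ∈ w c, x ∈ C) : ∀ (k : ℕ) (φ : Fml (m + k)),
    Fml.Realize C (Fml.ballK c k φ) w ↔
      ∀ v : Fin k → ZFSet.{u}, (∀ i, v i ∈ w c) → Fml.Realize C φ (Fin.append w v)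
  | 0, φ => by
    have : ∀ v : Fin 0 → ZFSet.{u}, Fin.append w v = w := by
      intro v; funext i; exact Fin.append_left w v i
    simp [Fml.ballK, this]
  | k + 1, φ => by
    rw [Fml.ballK, realize_ballK C c w hw k]
    simp only [realize_all, realize_imp, realize_mem, Fin.snoc_last, Fin.snoc_castSucc,
      Fin.append_left]
    constructor
    · intro h v hv
      have := h (Fin.init v) (fun i => hv _) (v (Fin.last _)) (hw _ (hv _)) (hv _)
      rw [← Fin.append_snoc, Fin.snoc_init_self] at this
      exact this
    · intro h v hv x _ hx
      have := h (Fin.snoc v x : Fin (k + 1) → ZFSet) (by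
        intro i
        refine Fin.lastCases ?_ (fun i => ?_) i
        · simpa using hx
        · simpa using hv i)
      rw [Fin.append_snoc] at this
      exact this

/-! #### Evaluation over subtypes -/

/-- Realization with variables typed as elements of the class. -/
def RS (C : Set ZFSet.{u}) {n : ℕ} (φ : Fml n) (v : Fin n → C) : Prop :=
  Fml.Realize C φ (fun i => (v i : ZFSet))

section RSlemmas
variable (C : Set ZFSet.{u}) {n : ℕ}

theorem RS_mem (i j : Fin n) (v : Fin n → C) :
    RS C (.mem i j) v ↔ (v i : ZFSet) ∈ (v j : ZFSet) := Iff.rfl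
theorem RS_eq (i j : Fin n) (v : Fin n → C) :
    RS C (.eq i j) v ↔ v i = v j := Subtype.ext_iff.symm
theorem RS_not (φ : Fml n) (v : Fin n → C) : RS C (.not φ) v ↔ ¬ RS C φ v := Iff.rfl
theorem RS_and (φ ψ : Fml n) (v : Fin n → C) :
    RS C (.and φ ψ) v ↔ RS C φ v ∧ RS C ψ v := Iff.rfl
theorem RS_or (φ ψ : Fml n) (v : Fin n → C) :
    RS C (Fml.or φ ψ) v ↔ RS C φ v ∨ RS C ψ v := realize_or C φ ψ _
theorem RS_imp (φ ψ : Fml n) (v : Fin n → C) :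
    RS C (Fml.imp φ ψ) v ↔ (RS C φ v → RS C ψ v) := realize_imp C φ ψ _
theorem RS_iff (φ ψ : Fml n) (v : Fin n → C) :
    RS C (Fml.iff φ ψ) v ↔ (RS C φ v ↔ RS C ψ v) := realize_iff C φ ψ _

theorem coe_snoc (v : Fin n → C) (x : C) :
    (fun i => ((Fin.snoc v x : Fin (n + 1) → C) i : ZFSet)) =
      (Fin.snoc (fun i => (v i : ZFSet)) (x : ZFSet) : Fin (n + 1) → ZFSet) := by
  funext i
  refine Fin.lastCases ?_ (fun i => ?_) i <;> simp

theorem RS_ex (φ : Fml (n + 1)) (v : Fin n → C) :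
    RS C (.ex φ) v ↔ ∃ x : C, RS C φ (Fin.snoc v x : Fin (n + 1) → C) := by
  simp only [RS, realize_ex, coe_snoc, Subtype.exists, exists_prop]

theorem RS_all (φ : Fml (n + 1)) (v : Fin n → C) :
    RS C (Fml.all φ) v ↔ ∀ x : C, RS C φ (Fin.snoc v x : Fin (n + 1) → C) := by
  simp only [RS, realize_all, coe_snoc, Subtype.forall]

/-- `p = {a, b}`. -/
def upF (p a b : Fin n) : Fml n :=
  Fml.all (Fml.iff (.mem (Fin.last n) p.castSucc)
    (Fml.or (.eq (Fin.last n) a.castSucc) (.eq (Fin.last n) b.castSucc)))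

/-- `p = (a, b)`. -/
def prF (p a b : Fin n) : Fml n :=
  .ex (.ex (.and (upF (Fin.last n).castSucc a.castSucc.castSucc a.castSucc.castSucc)
    (.and (upF (Fin.last (n + 1)) a.castSucc.castSucc b.castSucc.castSucc)
      (upF p.castSucc.castSucc (Fin.last n).castSucc (Fin.last (n + 1))))))

variable {C} (hC : TransClass C)
include hC

theorem RS_upF (p a b : Fin n) (v : Fin n → C) :
    RS C (upF p a b) v ↔ (v p : ZFSet) = {(v a : ZFSet), (v b : ZFSet)} := by
  simp only [upF, RS_all, RS_iff, RS_or, RS_mem, RS_eq, Fin.snoc_last, Fin.snoc_castSucc]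
  constructor
  · intro h
    ext z
    rw [ZFSet.mem_pair]
    constructor
    · intro hz
      have := (h ⟨z, hC _ (v p).2 _ hz⟩).1 hz
      simpa [Subtype.ext_iff] using this
    · rintro (rfl | rfl)
      · exact (h (v a)).2 (Or.inl rfl)
      · exact (h (v b)).2 (Or.inr rfl)
  · intro h x
    rw [h, ZFSet.mem_pair, Subtype.ext_iff, Subtype.ext_iff]

theorem RS_prF (p a b : Fin n) (v : Fin n → C) :
    RS C (prF p a b) v ↔ (v p : ZFSet) = ZFSet.pair (v a) (v b) := by
  simp only [prF, RS_ex, RS_and, RS_upF hC, Fin.snoc_last, Fin.snoc_castSucc]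
  constructor
  · rintro ⟨x, y, h1, h2, h3⟩
    rw [h3, h1, h2, ZFSet.pair_eq_singleton]; rfl
  · intro h
    have h1 : ({(v a : ZFSet)} : ZFSet) ∈ (v p : ZFSet) := by
      rw [h, ZFSet.pair, ZFSet.mem_pair]; exact Or.inl rfl
    have h2 : ({(v a : ZFSet), (v b : ZFSet)} : ZFSet) ∈ (v p : ZFSet) := by
      rw [h, ZFSet.pair, ZFSet.mem_pair]; exact Or.inr rfl
    exact ⟨⟨_, hC _ (v p).2 _ h1⟩, ⟨_, hC _ (v p).2 _ h2⟩,
      (ZFSet.pair_eq_singleton _).symm, rfl, h⟩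

end RSlemmas

theorem snoc1 {α : Type*} (a b : α) : (Fin.snoc ![a] b : Fin 2 → α) = ![a, b] := by
  funext i; fin_cases i <;> rfl
theorem snoc2 {α : Type*} (a b c : α) : (Fin.snoc ![a, b] c : Fin 3 → α) = ![a, b, c] := by
  funext i; fin_cases i <;> rfl
theorem snoc3 {α : Type*} (a b c d : α) :
    (Fin.snoc ![a, b, c] d : Fin 4 → α) = ![a, b, c, d] := by
  funext i; fin_cases i <;> rfl
theorem snoc4 {α : Type*} (a b c d e : α) :
    (Fin.snoc ![a, b, c, d] e : Fin 5 → α) = ![a, b, c, d, e] := by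
  funext i; fin_cases i <;> rfl
theorem snoc5 {α : Type*} (a b c d e f : α) :
    (Fin.snoc ![a, b, c, d, e] f : Fin 6 → α) = ![a, b, c, d, e, f] := by
  funext i; fin_cases i <;> rfl
theorem snoc6 {α : Type*} (a b c d e f g : α) :
    (Fin.snoc ![a, b, c, d, e, f] g : Fin 7 → α) = ![a, b, c, d, e, f, g] := by
  funext i; fin_cases i <;> rfl

/-! #### Transfer along an elementary embedding of the universe -/

theorem pair_mem_class {M : Set ZFSet.{u}} (hM : TransClass M) {f x y : ZFSet.{u}} (hf : f ∈ M)
    (h : x.pair y ∈ f) : x.pair y ∈ M ∧ x ∈ M ∧ y ∈ M := by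
  have h0 := hM _ hf _ h
  have h2 : ({x, y} : ZFSet) ∈ x.pair y := by
    rw [ZFSet.pair, ZFSet.mem_pair]; exact Or.inr rfl
  have h3 := hM _ h0 _ h2
  exact ⟨h0, hM _ h3 _ (by simp), hM _ h3 _ (by simp)⟩

section Transfer
variable {M : Set ZFSet.{u}} (hM : TransClass M) (E : ElemEmb (Set.univ : Set ZFSet.{u}) M)

theorem transUniv : TransClass (Set.univ : Set ZFSet.{u}) := fun _ _ _ _ => trivial

/-- `E.toFun` as a map to the subtype. -/
def emb (x : ZFSet.{u}) : M := ⟨E.toFun x, E.maps x trivial⟩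

/-- Elements of the universe as members of `Set.univ`. -/
def uu (x : ZFSet.{u}) : (Set.univ : Set ZFSet.{u}) := ⟨x, trivial⟩

theorem elem1 (φ : Fml 1) (a : ZFSet.{u}) : RS Set.univ φ ![uu a] ↔ RS M φ ![emb E a] := by
  have := E.elem φ ![a] (fun _ => trivial)
  convert this using 1 <;> (unfold RS; congr! 1; funext i; fin_cases i <;> rfl)
theorem elem2 (φ : Fml 2) (a b : ZFSet.{u}) :
    RS Set.univ φ ![uu a, uu b] ↔ RS M φ ![emb E a, emb E b] := by
  have := E.elem φ ![a, b] (fun _ => trivial)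
  convert this using 1 <;> (unfold RS; congr! 1; funext i; fin_cases i <;> rfl)
theorem elem3 (φ : Fml 3) (a b c : ZFSet.{u}) :
    RS Set.univ φ ![uu a, uu b, uu c] ↔ RS M φ ![emb E a, emb E b, emb E c] := by
  have := E.elem φ ![a, b, c] (fun _ => trivial)
  convert this using 1 <;> (unfold RS; congr! 1; funext i; fin_cases i <;> rfl)

theorem emb_mem (a b : ZFSet.{u}) : E.toFun a ∈ E.toFun b ↔ a ∈ b := by
  have := elem2 E (.mem 0 1) a b
  simpa [RS_mem, uu, emb] using this.symm

theorem emb_inj (a b : ZFSet.{u}) : E.toFun a = E.toFun b ↔ a = b := by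
  have := elem2 E (.eq 0 1) a b
  simp [RS_eq, uu, emb, Subtype.ext_iff] at this
  exact this.symm

include hM

theorem emb_sub {a b : ZFSet.{u}} (h : a ⊆ b) : E.toFun a ⊆ E.toFun b := by
  have := elem2 E (.all (.imp (.mem 2 0) (.mem 2 1))) a b
  simp only [RS_all, RS_imp, RS_mem, snoc2] at this
  simp [uu, emb] at this
  intro x hx
  exact this.1 (fun z hz => h hz) x (hM _ (E.maps a trivial) _ hx) hx

theorem emb_sub2 {a b : ZFSet.{u}} (h : ∀ z ∈ a, ∀ y ∈ z, y ∈ b) :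
    ∀ z ∈ E.toFun a, ∀ y ∈ z, y ∈ E.toFun b := by
  have := elem2 E (.all (.imp (.mem 2 0) (.all (.imp (.mem 3 2) (.mem 3 1))))) a b
  simp only [RS_all, RS_imp, RS_mem, snoc2, snoc3] at this
  simp [uu, emb] at this
  intro z hz y hy
  have hz' := hM _ (E.maps a trivial) _ hz
  exact this.1 h z hz' hz y (hM _ hz' _ hy) hy

theorem emb_agree {d a b : ZFSet.{u}} (h : ∀ z ∈ d, (z ∈ a ↔ z ∈ b)) :
    ∀ z ∈ E.toFun d, (z ∈ E.toFun a ↔ z ∈ E.toFun b) := by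
  have := elem3 E (.all (.imp (.mem 3 0) (.iff (.mem 3 1) (.mem 3 2)))) d a b
  simp only [RS_all, RS_imp, RS_iff, RS_mem, snoc3] at this
  simp [uu, emb] at this
  intro z hz
  exact this.1 h z (hM _ (E.maps d trivial) _ hz) hz

theorem emb_trans {a : ZFSet.{u}} (h : a.IsTransitive) : (E.toFun a).IsTransitive := by
  intro z hz y hy
  exact emb_sub2 hM E (fun z hz y hy => h z hz hy) z hz y hy

theorem emb_ord {a : ZFSet.{u}} (h : IsOrd a) : IsOrd (E.toFun a) := by
  refine ⟨emb_trans hM E h.1, ?_⟩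
  have := elem1 E (.all (.imp (.mem 1 0) (.all (.imp (.mem 2 1)
    (.all (.imp (.mem 3 2) (.mem 3 1))))))) a
  simp only [RS_all, RS_imp, RS_mem, snoc1, snoc2, snoc3] at this
  simp [uu, emb] at this
  intro z hz y hy w hw
  have hz' := hM _ (E.maps a trivial) _ hz
  have hy' := hM _ hz' _ hy
  exact this.1 (fun z hz y hy w hw => h.2 z hz y hy hw) z hz' hz y hy' hy w (hM _ hy' _ hw) hw

theorem emb_pair (a b : ZFSet.{u}) :
    E.toFun (a.pair b) = (E.toFun a).pair (E.toFun b) := by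
  have := elem3 E (prF 0 1 2) (a.pair b) a b
  rw [RS_prF hM, RS_prF transUniv] at this
  exact this.1 rfl

theorem emb_func {s f : ZFSet.{u}} (h : IsFuncOn s f) : IsFuncOn (E.toFun s) (E.toFun f) := by
  have e1 := elem2 E (.all (.imp (.mem 2 1) (.ex (.and (.mem 3 0) (.ex (prF 2 3 4)))))) s f
  have e2 := elem2 E (.all (.imp (.mem 2 0) (.ex (.ex (.and (.mem 4 1) (prF 4 2 3)))))) s f
  have e3 := elem1 E (.all (.all (.all (.imp (.ex (.and (.mem 4 0) (prF 4 1 2)))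
    (.imp (.ex (.and (.mem 4 0) (prF 4 1 3))) (.eq 2 3)))))) f
  simp only [RS_all, RS_imp, RS_mem, RS_ex, RS_and, RS_eq, RS_prF hM, RS_prF transUniv,
    snoc1, snoc2, snoc3, snoc4] at e1 e2 e3
  simp [uu, emb] at e1 e2 e3
  have hs := E.maps s trivial
  have hf := E.maps f trivial
  have e1 := e1.1 (fun p hp => by
    obtain ⟨a, b, ha, rfl⟩ := h.1 p hp
    exact ⟨a, ha, b, rfl⟩)
  have e2 := e2.1 (fun a ha => (h.2 a ha).exists)
  have e3 := e3.1 (fun a b c hb hc => by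
    obtain ⟨a', b', ha, hp⟩ := h.1 _ hb
    obtain ⟨rfl, rfl⟩ := ZFSet.pair_inj.1 hp
    exact (h.2 _ ha).unique hb hc)
  refine ⟨?_, ?_⟩
  · intro p hp
    obtain ⟨a, ha, _, b, _, rfl⟩ := e1 p (hM _ hf _ hp) hp
    exact ⟨a, b, ha, rfl⟩
  · intro a ha
    have haM := hM _ hs _ ha
    obtain ⟨b, hb, hbM, hp⟩ := e2 a haM ha
    refine ⟨b, hb, fun c hc => ?_⟩
    have hc' := pair_mem_class hM hf hc
    exact e3 a haM c hc'.2.2 b hbM hc hc'.1 hb hp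

theorem emb_maps {f b : ZFSet.{u}} (h : MapsInto f b) : MapsInto (E.toFun f) (E.toFun b) := by
  have e1 := elem2 E (.all (.all (.imp (.ex (.and (.mem 4 0) (prF 4 2 3))) (.mem 3 1)))) f b
  simp only [RS_all, RS_imp, RS_mem, RS_ex, RS_and, RS_eq, RS_prF hM, RS_prF transUniv,
    snoc1, snoc2, snoc3, snoc4] at e1
  simp [uu, emb] at e1
  intro x y hxy
  have hp := pair_mem_class hM (E.maps f trivial) hxy
  exact e1.1 h x hp.2.1 y hp.2.2 hxy hp.1

theorem emb_injFun {f : ZFSet.{u}} (h : InjFun f) : InjFun (E.toFun f) := by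
  have e1 := elem1 E (.all (.all (.all (.imp (.ex (.and (.mem 4 0) (prF 4 1 3)))
    (.imp (.ex (.and (.mem 4 0) (prF 4 2 3))) (.eq 1 2)))))) f
  simp only [RS_all, RS_imp, RS_mem, RS_ex, RS_and, RS_eq, RS_prF hM, RS_prF transUniv,
    snoc1, snoc2, snoc3, snoc4] at e1
  simp [uu, emb] at e1
  intro x x' y hx hx'
  have hp := pair_mem_class hM (E.maps f trivial) hx
  have hp' := pair_mem_class hM (E.maps f trivial) hx'
  exact e1.1 h x hp.2.1 x' hp'.2.1 y hp.2.2 hx hp.1 hx' hp'.1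

theorem emb_R1 {κ r : ZFSet.{u}} (h : ∀ α ∈ κ, ∀ x : ZFSet.{u},
      (∀ y ∈ x, ∃ β ∈ α, y.pair β ∈ r) → x.pair α ∈ r) :
    ∀ α ∈ E.toFun κ, ∀ x ∈ M, (∀ y ∈ x, ∃ β ∈ α, y.pair β ∈ E.toFun r) →
      x.pair α ∈ E.toFun r := by
  have e1 := elem2 E (.all (.imp (.mem 2 0) (.all (.imp (.all (.imp (.mem 4 3) (.ex (.and
    (.mem 5 2) (.ex (.and (.mem 6 1) (prF 6 4 5))))))) (.ex (.and (.mem 4 1) (prF 4 3 2))))))) κ r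
  simp only [RS_all, RS_imp, RS_mem, RS_ex, RS_and, RS_eq, RS_prF hM, RS_prF transUniv,
    snoc1, snoc2, snoc3, snoc4, snoc5, snoc6] at e1
  simp [uu, emb] at e1
  intro α hα x hx hy
  refine (e1.1 h α (hM _ (E.maps κ trivial) _ hα) hα x hx ?_).1
  intro y _ hyx
  obtain ⟨β, hβ, hp⟩ := hy y hyx
  have hp' := pair_mem_class hM (E.maps r trivial) hp
  exact ⟨β, hβ, hp, hp'.2.2, hp'.1⟩

theorem emb_R2 {r : ZFSet.{u}} (h : ∀ x α : ZFSet.{u}, x.pair α ∈ r →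
      ∀ y ∈ x, ∃ β ∈ α, y.pair β ∈ r) :
    ∀ x α : ZFSet.{u}, x.pair α ∈ E.toFun r → ∀ y ∈ x, ∃ β ∈ α, y.pair β ∈ E.toFun r := by
  have e1 := elem1 E (.all (.all (.imp (.ex (.and (.mem 3 0) (prF 3 1 2)))
    (.all (.imp (.mem 3 1) (.ex (.and (.mem 4 2) (.ex (.and (.mem 5 0) (prF 5 3 4)))))))))) r
  simp only [RS_all, RS_imp, RS_mem, RS_ex, RS_and, RS_eq, RS_prF hM, RS_prF transUniv,
    snoc1, snoc2, snoc3, snoc4, snoc5, snoc6] at e1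
  simp [uu, emb] at e1
  intro x α hp y hy
  have hp' := pair_mem_class hM (E.maps r trivial) hp
  obtain ⟨β, hβ, hq, _⟩ := e1.1 h x hp'.2.1 α hp'.2.2 hp hp'.1 y (hM _ hp'.2.1 _ hy) hy
  exact ⟨β, hβ, hq⟩

theorem emb_R3 {r d : ZFSet.{u}} (h : ∀ x α : ZFSet.{u}, x.pair α ∈ r → x ∈ d) :
    ∀ x α : ZFSet.{u}, x.pair α ∈ E.toFun r → x ∈ E.toFun d := by
  have e1 := elem2 E (.all (.all (.imp (.ex (.and (.mem 4 0) (prF 4 2 3))) (.mem 2 1)))) r d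
  simp only [RS_all, RS_imp, RS_mem, RS_ex, RS_and, RS_eq, RS_prF hM, RS_prF transUniv,
    snoc1, snoc2, snoc3, snoc4, snoc5, snoc6] at e1
  simp [uu, emb] at e1
  intro x α hp
  have hp' := pair_mem_class hM (E.maps r trivial) hp
  exact e1.1 h x hp'.2.1 α hp'.2.2 hp hp'.1

end Transfer

/-! #### Images of elementary substructures -/

section Images
variable {M : Set ZFSet.{u}} (hM : TransClass M) (E : ElemEmb (Set.univ : Set ZFSet.{u}) M)
include hM

theorem emb_set_elem (n : ZFSet.{u}) {k : ℕ} (φ : Fml k) (v : Fin k → ZFSet.{u}) :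
    Fml.Realize n.toSet φ v ↔ Fml.Realize (E.toFun n).toSet φ (fun i => E.toFun (v i)) := by
  have h := E.elem (Fml.rel Fin.castSucc (Fin.last k) φ)
    (Fin.snoc v n : Fin (k + 1) → ZFSet) (fun _ => trivial)
  rw [realize_rel Set.univ _ _ _ _ (fun _ _ => trivial),
    realize_rel _ _ _ _ _ (by
      intro x hx
      simp only [Fin.snoc_last] at hx
      exact hM _ (E.maps n trivial) _ hx)] at h
  simpa using h

/-- The formula expressing that variable `0` agrees with variable `1` about `φ`. -/
def agreeF {k : ℕ} (φ : Fml k) : Fml 2 :=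
  Fml.ballK 0 k (Fml.iff (Fml.rel (Fin.natAdd 2) (Fin.castAdd k 0) φ)
    (Fml.rel (Fin.natAdd 2) (Fin.castAdd k 1) φ))

omit hM in
theorem realize_agreeF (C : Set ZFSet.{u}) {k : ℕ} (φ : Fml k) (w : Fin 2 → ZFSet.{u})
    (h0 : ∀ x ∈ w 0, x ∈ C) (h1 : ∀ x ∈ w 1, x ∈ C) :
    Fml.Realize C (agreeF φ) w ↔ ∀ v : Fin k → ZFSet.{u}, (∀ i, v i ∈ w 0) →
      (Fml.Realize (w 0).toSet φ v ↔ Fml.Realize (w 1).toSet φ v) := by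
  rw [agreeF, realize_ballK C 0 w h0]
  refine forall₂_congr fun v hv => ?_
  rw [realize_iff, realize_rel _ _ _ _ _ (by rw [Fin.append_left]; exact h0),
    realize_rel _ _ _ _ _ (by rw [Fin.append_left]; exact h1)]
  simp only [Fin.append_left, Fin.append_right]

theorem emb_esub {N : Set ZFSet.{u}} {n n' : ZFSet.{u}} (hn : ESub n N) (hn' : ESub n' N)
    (hs : n ⊆ n') {k : ℕ} (φ : Fml k) (y : Fin k → ZFSet.{u}) (hy : ∀ i, y i ∈ E.toFun n) :
    Fml.Realize (E.toFun n).toSet φ y ↔ Fml.Realize (E.toFun n').toSet φ y := by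
  have h := E.elem (agreeF φ) ![n, n'] (fun _ => trivial)
  rw [realize_agreeF Set.univ _ _ (fun _ _ => trivial) (fun _ _ => trivial),
    realize_agreeF _ _ _ (fun x hx => hM _ (E.maps n trivial) _ hx)
      (fun x hx => hM _ (E.maps n' trivial) _ hx)] at h
  refine h.1 ?_ y hy
  intro v hv
  exact (hn.2 φ v hv).trans (hn'.2 φ v (fun i => hs (hv i))).symm

/-- The image of the class `N`. -/
def MM (N : Set ZFSet.{u}) (E : ElemEmb (Set.univ : Set ZFSet.{u}) M) : Set ZFSet.{u} :=
  {y | ∃ n, ESub n N ∧ y ∈ E.toFun n}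

theorem realize_MM {N : Set ZFSet.{u}} {d : ZFSet.{u}} (hd : d ∈ N) {k : ℕ} (φ : Fml k) :
    ∀ (n : ZFSet.{u}), ESub n N → ∀ y : Fin k → ZFSet.{u}, (∀ i, y i ∈ E.toFun n) →
      (Fml.Realize (E.toFun n).toSet φ y ↔ Fml.Realize (MM N E) φ y) := by
  induction φ with
  | mem i j => intro n hn y _; exact Iff.rfl
  | eq i j => intro n hn y _; exact Iff.rfl
  | not φ ih => intro n hn y hy; exact not_congr (ih n hn y hy)
  | and φ ψ ih1 ih2 => intro n hn y hy; exact and_congr (ih1 n hn y hy) (ih2 n hn y hy)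
  | @ex m φ ih =>
    intro n hn y hy
    have key : ∀ (n : ZFSet.{u}) (x : ZFSet.{u}), (∀ i, y i ∈ E.toFun n) → x ∈ E.toFun n →
        ∀ i, (Fin.snoc y x : Fin (m + 1) → ZFSet) i ∈ E.toFun n := by
      intro n x hy hx i
      refine Fin.lastCases ?_ (fun i => ?_) i
      · simpa using hx
      · simpa using hy i
    constructor
    · rintro ⟨x, hx, h⟩
      exact ⟨x, ⟨n, hn, hx⟩, (ih n hn _ (key n x hy hx)).1 h⟩
    · rintro ⟨x, ⟨n2, hn2, hx⟩, h⟩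
      obtain ⟨n3, hsub, hn3⟩ := exists_hull N d hd (n ∪ n2) (by
        intro z hz
        rcases ZFSet.mem_union.1 hz with hz | hz
        · exact hn.1 z hz
        · exact hn2.1 z hz)
      have hs1 : n ⊆ n3 := fun z hz => hsub (ZFSet.mem_union.2 (Or.inl hz))
      have hs2 : n2 ⊆ n3 := fun z hz => hsub (ZFSet.mem_union.2 (Or.inr hz))
      have hx3 := emb_sub hM E hs2 hx
      have hy3 : ∀ i, y i ∈ E.toFun n3 := fun i => emb_sub hM E hs1 (hy i)
      exact (emb_esub hM E hn hn3 hs1 (.ex φ) y hy).2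
        ⟨x, hx3, (ih n3 hn3 _ (key n3 x hy3 hx3)).2 h⟩

theorem mem_MM {N : Set ZFSet.{u}} {x : ZFSet.{u}} (hx : x ∈ N) : E.toFun x ∈ MM N E := by
  obtain ⟨n, h1, h2⟩ := exists_hull N x hx {x} (by
    intro z hz; rw [ZFSet.mem_singleton] at hz; rwa [hz])
  exact ⟨n, h2, (emb_mem E _ _).2 (h1 (ZFSet.mem_singleton.2 rfl))⟩

theorem trans_MM {N : Set ZFSet.{u}} (hN : TransClass N) {d : ZFSet.{u}} (hd : d ∈ N) :
    TransClass (MM N E) := by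
  rintro x ⟨n, hn, hx⟩ y hy
  obtain ⟨n', h1, h2⟩ := exists_hull N d hd (ZFSet.sUnion n) (by
    intro z hz
    obtain ⟨w, hw, hzw⟩ := ZFSet.mem_sUnion.1 hz
    exact hN _ (hn.1 w hw) _ hzw)
  exact ⟨n', h2, emb_sub2 hM E
    (fun z hz w hw => h1 (ZFSet.mem_sUnion.2 ⟨z, hz, hw⟩)) x hx y hy⟩

/-- The composite embedding. -/
def compEmb {N : Set ZFSet.{u}} (hN : TransClass N) (i : ElemEmb (Set.univ : Set ZFSet.{u}) N) :
    ElemEmb (Set.univ : Set ZFSet.{u}) (MM N E) where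
  toFun x := E.toFun (i.toFun x)
  maps x _ := mem_MM hM E (i.maps x trivial)
  elem := by
    intro k φ v hv
    have hd : i.toFun ∅ ∈ N := i.maps ∅ trivial
    obtain ⟨n, h1, h2⟩ := exists_hull N _ hd (ZFSet.range (fun l => i.toFun (v l))) (by
      intro z hz
      obtain ⟨l, rfl⟩ := ZFSet.mem_range.1 hz
      exact i.maps _ trivial)
    have hmem : ∀ l, i.toFun (v l) ∈ n := fun l => h1 (ZFSet.mem_range.2 ⟨l, rfl⟩)
    rw [i.elem φ v hv, ← h2.2 φ _ hmem, emb_set_elem hM E,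
      realize_MM hM E hd φ n h2 _ (fun l => (emb_mem E _ _).2 (hmem l))]

end Images

/-! #### Ranks -/

theorem IsOrd.ordinal {x : ZFSet.{u}} (h : IsOrd x) : x.IsOrdinal :=
  ZFSet.isOrdinal_iff_forall_mem_isTransitive.2 ⟨h.1, fun y hy => h.2 y hy⟩

theorem toZFSet_mem_of_lt {x : ZFSet.{u}} (h : x.IsOrdinal) {o : Ordinal.{u}} (ho : o < x.rank) :
    o.toZFSet ∈ x := by
  rw [← h.toZFSet_rank_eq]
  exact Ordinal.toZFSet_mem_toZFSet_iff.2 ho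

/-- The relation `rank x ≤ α`, for `α ∈ κ`. -/
noncomputable def rkRel (κ : ZFSet.{u}) : ZFSet.{u} :=
  ZFSet.sep (fun p => ∃ x α : ZFSet.{u}, p = x.pair α ∧ x.rank ≤ α.rank)
    (ZFSet.prod (ZFSet.vonNeumann κ.rank) κ)

theorem pair_mem_rkRel {κ x α : ZFSet.{u}} :
    x.pair α ∈ rkRel κ ↔ α ∈ κ ∧ x.rank ≤ α.rank := by
  rw [rkRel, ZFSet.mem_sep, ZFSet.pair_mem_prod, ZFSet.mem_vonNeumann]
  constructor
  · rintro ⟨⟨_, h⟩, x', α', hp, hr⟩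
    obtain ⟨rfl, rfl⟩ := ZFSet.pair_inj.1 hp
    exact ⟨h, hr⟩
  · rintro ⟨h, hr⟩
    exact ⟨⟨hr.trans_lt (ZFSet.rank_lt_of_mem h), h⟩, x, α, rfl, hr⟩

section Rank
variable {M : Set ZFSet.{u}} (hM : TransClass M) (E : ElemEmb (Set.univ : Set ZFSet.{u}) M)
  {κ : ZFSet.{u}} (hκ : IsCrit E κ)
include hM hκ

theorem rank_le_of_emb (x : ZFSet.{u}) :
    ∀ α : ZFSet.{u}, x.pair α ∈ E.toFun (rkRel κ) → x.rank ≤ α.rank := by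
  have hR := emb_R2 hM E (r := rkRel κ) (by
    intro x α h y hy
    rw [pair_mem_rkRel] at h
    obtain ⟨β, hβ, hyβ⟩ := ZFSet.lt_rank_iff.1 ((ZFSet.rank_lt_of_mem hy).trans_le h.2)
    exact ⟨β, hβ, pair_mem_rkRel.2 ⟨hκ.1.1 α h.1 hβ, hyβ⟩⟩)
  induction x using ZFSet.inductionOn with
  | _ x ih =>
    intro α h
    rw [ZFSet.rank_le_iff]
    intro y hy
    obtain ⟨β, hβ, hp⟩ := hR x α h y hy
    exact (ih y hy β hp).trans_lt (ZFSet.rank_lt_of_mem hβ)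

theorem emb_fix : ∀ (o : Ordinal.{u}) (x : ZFSet.{u}), x.rank = o → x.rank < κ.rank →
    E.toFun x = x := by
  intro o
  induction o using WellFoundedLT.induction with
  | _ o ih =>
    rintro x rfl hx
    have hα := toZFSet_mem_of_lt hκ.1.ordinal hx
    have hp : x.pair x.rank.toZFSet ∈ rkRel κ := pair_mem_rkRel.2 ⟨hα, by simp⟩
    have hp' := (emb_mem E _ _).2 hp
    rw [emb_pair hM, hκ.2.2 _ hα] at hp'
    have hr := rank_le_of_emb hM E hκ _ _ hp'
    rw [Ordinal.rank_toZFSet] at hr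
    ext z
    constructor
    · intro hz
      have hzr := (ZFSet.rank_lt_of_mem hz).trans_le hr
      have hfix := ih _ hzr z rfl (hzr.trans hx)
      rw [← hfix] at hz
      exact (emb_mem E _ _).1 hz
    · intro hz
      have hzr := ZFSet.rank_lt_of_mem hz
      have hfix := ih _ hzr z rfl (hzr.trans hx)
      rw [← hfix]
      exact (emb_mem E _ _).2 hz

theorem mem_emb_vonNeumann {lam : ZFSet.{u}} (hlam : lam ∈ E.toFun κ) (hV : VIncl M lam)
    (x : ZFSet.{u}) (hx : x.rank < lam.rank) :
    x ∈ E.toFun (ZFSet.vonNeumann κ.rank) := by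
  have hjκ : IsOrd (E.toFun κ) := emb_ord hM E hκ.1
  have hlo : lam.IsOrdinal := hjκ.ordinal.mem hlam
  have hR := emb_R1 hM E (κ := κ) (r := rkRel κ) (by
    intro α hα x h
    refine pair_mem_rkRel.2 ⟨hα, ?_⟩
    rw [ZFSet.rank_le_iff]
    intro y hy
    obtain ⟨β, hβ, hp⟩ := h y hy
    exact (pair_mem_rkRel.1 hp).2.trans_lt (ZFSet.rank_lt_of_mem hβ))
  have main : ∀ x : ZFSet.{u}, x.rank < lam.rank →
      x.pair x.rank.toZFSet ∈ E.toFun (rkRel κ) := by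
    intro x
    induction x using ZFSet.inductionOn with
    | _ x ih =>
      intro hx
      refine hR _ (hjκ.1 _ hlam (toZFSet_mem_of_lt hlo hx)) x (hV x trivial hx) ?_
      intro y hy
      have hyr := ZFSet.rank_lt_of_mem hy
      exact ⟨y.rank.toZFSet, Ordinal.toZFSet_mem_toZFSet_iff.2 hyr, ih y hy (hyr.trans hx)⟩
  refine emb_R3 hM E (r := rkRel κ) ?_ _ _ (main x hx)
  intro x α h
  rw [pair_mem_rkRel] at h
  exact ZFSet.mem_vonNeumann.2 (h.2.trans_lt (ZFSet.rank_lt_of_mem h.1))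

end Rank

theorem core {κ lam : ZFSet.{u}} (hκlam : oLe κ lam) (hsc : LamSC κ lam)
    {M : Set ZFSet.{u}} (hM : TransClass M) (j : ElemEmb (Set.univ : Set ZFSet.{u}) M)
    (hj : IsCrit j κ) (hlj : lam ∈ j.toFun κ) (hV : VIncl M lam) :
    ∃ M' : Set ZFSet.{u}, TransClass M' ∧ ∃ k : ElemEmb (Set.univ : Set ZFSet.{u}) M',
      IsCrit k κ ∧ lam ∈ k.toFun κ ∧ VIncl M' lam ∧ WCovers M' k.toFun κ lam ∧
        ∀ A : ZFSet.{u}, AgreeBelow lam A (j.toFun A) → AgreeBelow lam A (k.toFun A) := by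
  obtain ⟨N, -, hN, i, hi, hli, s, hsN, hs, β, f, hβ, hf, hf1, hf2, hf3⟩ := hsc
  have hiκ : IsOrd (i.toFun κ) := emb_ord hN i hi.1
  have hκi : κ ∈ i.toFun κ := by
    rcases hκlam with h | h
    · exact hiκ.1 _ hli h
    · rw [h] at hli ⊢; exact hli
  have hjiκ : IsOrd (j.toFun (i.toFun κ)) := emb_ord hM j hiκ
  have hjκ : j.toFun κ ∈ j.toFun (i.toFun κ) := (emb_mem j _ _).2 hκi
  have hlk : lam ∈ j.toFun (i.toFun κ) := hjiκ.1 _ hjκ hlj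
  have hκk : κ ∈ j.toFun (i.toFun κ) := by
    rcases hκlam with h | h
    · exact hjiκ.1 _ hlk h
    · rw [h] at hlk ⊢; exact hlk
  have hd : i.toFun ∅ ∈ N := i.maps ∅ trivial
  have hfix : ∀ x ∈ ZFSet.vonNeumann κ.rank, i.toFun x = x := fun x hx =>
    emb_fix hN i hi _ x rfl (ZFSet.mem_vonNeumann.1 hx)
  refine ⟨MM N j, trans_MM hM j hN hd, compEmb hM j hN i, ⟨hi.1, ?_, ?_⟩, hlk, ?_, ?_, ?_⟩
  · change j.toFun (i.toFun κ) ≠ κ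
    intro h
    rw [h] at hκk
    exact ZFSet.mem_irrefl _ hκk
  · intro α hα
    change j.toFun (i.toFun α) = α
    rw [hi.2.2 α hα, hj.2.2 α hα]
  · intro x _ hx
    obtain ⟨n, h1, h2⟩ := exists_hull N _ hd (ZFSet.vonNeumann κ.rank) (by
      intro z hz
      rw [← hfix z hz]
      exact i.maps z trivial)
    exact ⟨n, h2, emb_sub hM j h1 (mem_emb_vonNeumann hM j hj hlj hV x hx)⟩
  · refine ⟨j.toFun s, mem_MM hM j hsN, fun α hα => (emb_mem j _ _).2 (hs α hα),
      j.toFun β, j.toFun f, (emb_mem j _ _).2 hβ, mem_MM hM j hf, emb_func hM j hf1,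
      emb_maps hM j hf2, emb_injFun hM j hf3⟩
  · intro A hA x _ hx
    refine (hA x trivial hx).trans ?_
    refine emb_agree hM j (d := ZFSet.vonNeumann κ.rank) ?_ x
      (mem_emb_vonNeumann hM j hj hlj hV x hx)
    intro z hz
    rw [← emb_mem i z A, hfix z hz]

end Aux

/-- **Proposition (strong + strongly compact).**  If `κ` is both `lam`-strong and
`lam`-strongly compact, then there is an embedding `j : V → M` with critical point
`κ`, `j κ > lam`, `V_lam ⊆ M`, satisfying the weak `lam`-covering property;
furthermore if `κ` is also `lam`-strong for `A`, then `j` can be chosen with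
`A ∩ V_lam = j A ∩ V_lam`. -/
theorem strong_and_compact (κ lam : ZFSet) (hκ : IsCard κ) (hκlam : oLe κ lam)
    (hstr : LamStrong κ lam) (hsc : LamSC κ lam) :
    (∃ M : Set ZFSet, TransClass M ∧ ∃ j : ElemEmb Set.univ M,
      IsCrit j κ ∧ lam ∈ j.toFun κ ∧ VIncl M lam ∧ WCovers M j.toFun κ lam) ∧
    (∀ A : ZFSet, LamStrongFor κ lam A →
      ∃ M : Set ZFSet, TransClass M ∧ ∃ j : ElemEmb Set.univ M,
        IsCrit j κ ∧ lam ∈ j.toFun κ ∧ VIncl M lam ∧ WCovers M j.toFun κ lam ∧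
          AgreeBelow lam A (j.toFun A)) := by
  obtain ⟨M, -, hM, j, hj, hlj, hV⟩ := hstr
  refine ⟨?_, ?_⟩
  · obtain ⟨M', hM', k, h1, h2, h3, h4, -⟩ := core hκlam hsc hM j hj hlj hV
    exact ⟨M', hM', k, h1, h2, h3, h4⟩
  · rintro A ⟨M₁, -, hM₁, j₁, hj₁, hlj₁, hV₁, hA⟩
    obtain ⟨M', hM', k, h1, h2, h3, h4, h5⟩ := core hκlam hsc hM₁ j₁ hj₁ hlj₁ hV₁
    exact ⟨M', hM', k, h1, h2, h3, h4, h5 A hA⟩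

end WSC
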